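/- arXiv:1710.00761 — 3 statements merged into one kernel-verified Lean document; each statement's English description precedes it below -/
import Mathlib

section
/- Suppose M₀, M₁, M₂, M₃ are four pairwise distinct perfect matchings of G forming a 4-cycle of the resonance graph R(G;F), i.e., M_j is adjacent to M_{j+1} in R(G;F) for every j with indices taken modulo 4. Then M₀ Δ M₁ = M₂ Δ M₃ and M₀ Δ M₃ = M₁ Δ M₂; moreover, the two even cycles M₀ Δ M₁ and M₀ Δ M₃ are vertex-disjoint, i.e., no vertex of G is incident both with an edge of M₀ Δ M₁ and with an edge of M₀ Δ M₃. -/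
open SimpleGraph

variable {V : Type*} {I : Type*}

/-- `M` is (the edge set of) a perfect matching of the graph `G`: a set of edges of `G`
such that every vertex of `G` is incident with exactly one edge of `M`. -/
def IsPM (G : SimpleGraph V) (M : Set (Sym2 V)) : Prop :=
  M ⊆ G.edgeSet ∧ ∀ v : V, ∃! e, e ∈ M ∧ v ∈ e

/-- `C` is the edge set of a connected 2-regular subgraph of `G`, i.e. a cycle of `G`. -/
def IsCycleSet (G : SimpleGraph V) (C : Set (Sym2 V)) : Prop :=
  C ⊆ G.edgeSet ∧ C.Nonempty ∧
    (∀ v ∈ (fromEdgeSet C).support, ((fromEdgeSet C).neighborSet v).ncard = 2) ∧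
    ∀ v ∈ (fromEdgeSet C).support, ∀ w ∈ (fromEdgeSet C).support,
      (fromEdgeSet C).Reachable v w

/-- `C` is an even cycle of `G`. -/
def IsEvenCycleSet (G : SimpleGraph V) (C : Set (Sym2 V)) : Prop :=
  IsCycleSet G C ∧ Even C.ncard

/-- The family `E : I → Set (Sym2 V)` is a face system on `G`: each `E i` is a set of
edges of `G`, every edge of `G` belongs to `E i` for exactly two indices `i`, and the
graph on `I` in which two distinct indices are adjacent iff their edge sets share an
edge is connected. -/
def IsFaceSystem (G : SimpleGraph V) (E : I → Set (Sym2 V)) : Prop :=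
  (∀ i, E i ⊆ G.edgeSet) ∧
  (∀ e ∈ G.edgeSet, {i : I | e ∈ E i}.ncard = 2) ∧
  (SimpleGraph.fromRel fun i j : I => (E i ∩ E j).Nonempty).Connected

/-- The resonance graph `R(G;F)`: its vertices are the perfect matchings of `G`, and two
perfect matchings are adjacent iff their symmetric difference is `E i` for some `i ∈ F`. -/
def resGraph (G : SimpleGraph V) (E : I → Set (Sym2 V)) (F : Set I) :
    SimpleGraph {M : Set (Sym2 V) // IsPM G M} :=
  SimpleGraph.fromRel fun M₁ M₂ => ∃ i ∈ F, symmDiff M₁.1 M₂.1 = E i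

/-- The vertex `v` is incident with some edge of the edge set `C`. -/
def coveredBy (C : Set (Sym2 V)) (v : V) : Prop := ∃ e ∈ C, v ∈ e

lemma local_eq {G : SimpleGraph V} {M₀ M₁ M₂ M₃ : Set (Sym2 V)}
    (h0 : IsPM G M₀) (h1 : IsPM G M₁) (h2 : IsPM G M₂) (h3 : IsPM G M₃)
    (hA : symmDiff M₀ M₁ = symmDiff M₂ M₃) (hB : symmDiff M₀ M₃ = symmDiff M₁ M₂)
    (v : V) (cA : coveredBy (symmDiff M₀ M₁) v) (cB : coveredBy (symmDiff M₀ M₃) v)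
    (e : Sym2 V) (he : v ∈ e) : e ∈ symmDiff M₀ M₁ ↔ e ∈ symmDiff M₀ M₃ := by
  have key : ∀ {M : Set (Sym2 V)}, IsPM G M → ∃ m, ∀ e, v ∈ e → (e ∈ M ↔ e = m) := by
    intro M hM
    obtain ⟨m, ⟨hm1, hm2⟩, hm⟩ := hM.2 v
    exact ⟨m, fun e he => ⟨fun h => hm e ⟨h, he⟩, fun h => h ▸ hm1⟩⟩
  have key2 : ∀ {M : Set (Sym2 V)}, IsPM G M → ∃ m ∈ M, v ∈ m :=
    fun hM => (hM.2 v).exists.imp fun _ h => h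
  obtain ⟨m0, k0⟩ := key h0
  obtain ⟨m1, k1⟩ := key h1
  obtain ⟨m2, k2⟩ := key h2
  obtain ⟨m3, k3⟩ := key h3
  obtain ⟨n0, a0, b0⟩ := key2 h0
  obtain ⟨n1, a1, b1⟩ := key2 h1
  obtain ⟨n2, a2, b2⟩ := key2 h2
  obtain ⟨n3, a3, b3⟩ := key2 h3
  obtain rfl := (k0 _ b0).1 a0
  obtain rfl := (k1 _ b1).1 a1
  obtain rfl := (k2 _ b2).1 a2
  obtain rfl := (k3 _ b3).1 a3
  obtain ⟨a, ha, hva⟩ := cA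
  obtain ⟨b, hb, hvb⟩ := cB
  have hA' : ∀ e, v ∈ e → ((e = n0 ∧ ¬ e = n1 ∨ e = n1 ∧ ¬ e = n0) ↔
      (e = n2 ∧ ¬ e = n3 ∨ e = n3 ∧ ¬ e = n2)) := by
    intro e he
    have := Set.ext_iff.1 hA e
    rwa [Set.mem_symmDiff, Set.mem_symmDiff, k0 e he, k1 e he, k2 e he, k3 e he] at this
  have hB' : ∀ e, v ∈ e → ((e = n0 ∧ ¬ e = n3 ∨ e = n3 ∧ ¬ e = n0) ↔
      (e = n1 ∧ ¬ e = n2 ∨ e = n2 ∧ ¬ e = n1)) := by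
    intro e he
    have := Set.ext_iff.1 hB e
    rwa [Set.mem_symmDiff, Set.mem_symmDiff, k0 e he, k1 e he, k2 e he, k3 e he] at this
  rw [Set.mem_symmDiff, k0 _ hva, k1 _ hva] at ha
  rw [Set.mem_symmDiff, k0 _ hvb, k3 _ hvb] at hb
  rw [Set.mem_symmDiff, Set.mem_symmDiff, k0 e he, k1 e he, k3 e he]
  have n01 : n0 ≠ n1 := by grind
  have n03 : n0 ≠ n3 := by grind
  have n13 : n1 = n3 := by
    have := hA' n1 b1
    have := hB' n1 b1
    have := hA' n0 b0
    have := hB' n0 b0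
    grind
  rw [n13]

lemma sub_of_local {G : SimpleGraph V} {A B : Set (Sym2 V)} (hA : IsCycleSet G A)
    (hl : ∀ v, coveredBy A v → coveredBy B v → ∀ e, v ∈ e → (e ∈ A ↔ e ∈ B))
    (v : V) (cA : coveredBy A v) (cB : coveredBy B v) : A ⊆ B := by
  have hsup : ∀ w, coveredBy A w → w ∈ (fromEdgeSet A).support := by
    rintro w ⟨e, he, hw⟩
    obtain ⟨u, rfl⟩ := hw
    exact ⟨u, (fromEdgeSet_adj A).2 ⟨he, (hA.1 he : G.Adj w u).ne⟩⟩
  have step : ∀ u w, (fromEdgeSet A).Walk u w → coveredBy B u → coveredBy B w := by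
    intro u w p
    induction p with
    | nil => exact id
    | cons h p ih =>
      intro hu
      apply ih
      rw [fromEdgeSet_adj] at h
      exact ⟨_, (hl _ ⟨_, h.1, Sym2.mem_mk_left _ _⟩ hu _ (Sym2.mem_mk_left _ _)).1 h.1,
        Sym2.mem_mk_right _ _⟩
  intro e he
  induction e with
  | _ x y =>
    have cx : coveredBy A x := ⟨_, he, Sym2.mem_mk_left _ _⟩
    obtain ⟨p⟩ := hA.2.2.2 v (hsup v cA) x (hsup x cx)
    exact (hl x cx (step _ _ p cB) _ (Sym2.mem_mk_left _ _)).1 he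

lemma adj_symm {G : SimpleGraph V} {E : I → Set (Sym2 V)} {F : Set I}
    {M N : {M : Set (Sym2 V) // IsPM G M}} (h : (resGraph G E F).Adj M N) :
    ∃ i ∈ F, symmDiff M.1 N.1 = E i := by
  rw [resGraph, fromRel_adj] at h
  obtain ⟨_, h | ⟨i, hi, h⟩⟩ := h
  · exact h
  · exact ⟨i, hi, by rw [symmDiff_comm, h]⟩

lemma all_of_closed [Fintype I] {G : SimpleGraph V} {E : I → Set (Sym2 V)}
    (hface : IsFaceSystem G E) {a b c d : I} (hab : a ≠ b) (hac : a ≠ c) (had : a ≠ d)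
    (hbc : b ≠ c) (hbd : b ≠ d) (hcd : c ≠ d)
    (hs : ∀ e, (Xor (e ∈ E a) (e ∈ E b) ↔ Xor (e ∈ E c) (e ∈ E d))) (i : I) :
    i = a ∨ i = b ∨ i = c ∨ i = d := by
  have two : ∀ e j k l, e ∈ E j → e ∈ E k → e ∈ E l → j ≠ k → l = j ∨ l = k := by
    intro e j k l hj hk hl hjk
    have h2 := hface.2.1 e (hface.1 j hj)
    have hsub : ({j, k} : Set I) ⊆ {i : I | e ∈ E i} := by
      rintro x (rfl | rfl) <;> assumption
    have heq := Set.eq_of_subset_of_ncard_le hsub (by rw [h2, Set.ncard_pair hjk])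
      (Set.toFinite _)
    have : l ∈ ({j, k} : Set I) := heq ▸ hl
    simpa using this
  have closed : ∀ j k, (SimpleGraph.fromRel fun i j : I => (E i ∩ E j).Nonempty).Walk j k →
      (j = a ∨ j = b ∨ j = c ∨ j = d) → (k = a ∨ k = b ∨ k = c ∨ k = d) := by
    intro j k p
    induction p with
    | nil => exact id
    | @cons u v w h p ih =>
      intro hu
      apply ih
      rw [fromRel_adj] at h
      have : ∃ e, e ∈ E u ∧ e ∈ E v := by
        obtain ⟨_, ⟨e, h1, h2⟩ | ⟨e, h1, h2⟩⟩ := h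
        exacts [⟨e, h1, h2⟩, ⟨e, h2, h1⟩]
      obtain ⟨e, h1, h2⟩ := this
      have hx := hs e
      have t := two e
      unfold Xor at hx
      by_cases ea : e ∈ E a <;> by_cases eb : e ∈ E b <;> by_cases ec : e ∈ E c <;>
        by_cases ed : e ∈ E d <;> simp only [ea, eb, ec, ed] at hx <;> grind
  obtain ⟨p⟩ := hface.2.2.preconnected a i
  exact closed a i p (Or.inl rfl)

/-- If `M₀, M₁, M₂, M₃` are four pairwise distinct perfect matchings of
`G` forming a 4-cycle of `R(G;F)`, then `M₀ Δ M₁ = M₂ Δ M₃` and `M₀ Δ M₃ = M₁ Δ M₂`;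
moreover the two even cycles `M₀ Δ M₁` and `M₀ Δ M₃` are vertex-disjoint. -/
theorem statement6 [Fintype V] [Fintype I] (G : SimpleGraph V)
    (E : I → Set (Sym2 V)) (hface : IsFaceSystem G E)
    (F : Set I) (hF : F ≠ Set.univ) (hFcyc : ∀ i ∈ F, IsEvenCycleSet G (E i))
    (M₀ M₁ M₂ M₃ : {M : Set (Sym2 V) // IsPM G M})
    (hdist : List.Pairwise Ne [M₀, M₁, M₂, M₃])
    (h01 : (resGraph G E F).Adj M₀ M₁) (h12 : (resGraph G E F).Adj M₁ M₂)
    (h23 : (resGraph G E F).Adj M₂ M₃) (h30 : (resGraph G E F).Adj M₃ M₀) :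
    symmDiff M₀.1 M₁.1 = symmDiff M₂.1 M₃.1 ∧
    symmDiff M₀.1 M₃.1 = symmDiff M₁.1 M₂.1 ∧
    ∀ v : V, ¬ (coveredBy (symmDiff M₀.1 M₁.1) v ∧ coveredBy (symmDiff M₀.1 M₃.1) v) := by
  obtain ⟨a, ha, ea⟩ := adj_symm h01
  obtain ⟨b, hb, eb⟩ := adj_symm h12
  obtain ⟨c, hc, ec⟩ := adj_symm h23
  obtain ⟨d, hd, ed⟩ := adj_symm h30
  have d02 : M₀.1 ≠ M₂.1 := fun h => by
    have : M₀ = M₂ := Subtype.ext h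
    simp_all
  have d13 : M₁.1 ≠ M₃.1 := fun h => by
    have : M₁ = M₃ := Subtype.ext h
    simp_all
  have hAB : symmDiff M₀.1 M₁.1 ≠ symmDiff M₁.1 M₂.1 := fun h => d02 (by
    rw [symmDiff_comm M₀.1] at h; exact symmDiff_right_injective _ h)
  have hBC : symmDiff M₁.1 M₂.1 ≠ symmDiff M₂.1 M₃.1 := fun h => d13 (by
    rw [symmDiff_comm M₁.1] at h; exact symmDiff_right_injective _ h)
  have hCD : symmDiff M₂.1 M₃.1 ≠ symmDiff M₃.1 M₀.1 := fun h => d02 (by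
    rw [symmDiff_comm M₂.1] at h; exact (symmDiff_right_injective _ h).symm)
  have hDA : symmDiff M₃.1 M₀.1 ≠ symmDiff M₀.1 M₁.1 := fun h => d13 (by
    rw [symmDiff_comm M₃.1] at h; exact (symmDiff_right_injective _ h).symm)
  have hiff : symmDiff M₀.1 M₁.1 = symmDiff M₂.1 M₃.1 ↔
      symmDiff M₁.1 M₂.1 = symmDiff M₃.1 M₀.1 := by
    simp only [Set.ext_iff, Set.mem_symmDiff]
    refine forall_congr' fun e => ?_
    clear * -
    generalize (e ∈ M₀.1) = p0, (e ∈ M₁.1) = p1, (e ∈ M₂.1) = p2, (e ∈ M₃.1) = p3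
    by_cases p0 <;> by_cases p1 <;> by_cases p2 <;> by_cases p3 <;> simp [*]
  have hA : symmDiff M₀.1 M₁.1 = symmDiff M₂.1 M₃.1 := by
    by_contra hne
    have hne' := mt hiff.2 hne
    refine hF (Set.eq_univ_of_forall fun i => ?_)
    have := all_of_closed hface (a := a) (b := b) (c := c) (d := d)
      (by rintro rfl; exact hAB (ea.trans eb.symm)) (by rintro rfl; exact hne (ea.trans ec.symm))
      (by rintro rfl; exact hDA (ed.trans ea.symm)) (by rintro rfl; exact hBC (eb.trans ec.symm))
      (by rintro rfl; exact hne' (eb.trans ed.symm)) (by rintro rfl; exact hCD (ec.trans ed.symm))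
      (by
        intro e
        rw [← ea, ← eb, ← ec, ← ed]
        simp only [Set.mem_symmDiff, Xor]
        clear * -
        generalize (e ∈ M₀.1) = p0, (e ∈ M₁.1) = p1, (e ∈ M₂.1) = p2, (e ∈ M₃.1) = p3
        by_cases p0 <;> by_cases p1 <;> by_cases p2 <;> by_cases p3 <;> simp [*]) i
    rcases this with rfl | rfl | rfl | rfl <;> assumption
  have hB : symmDiff M₀.1 M₃.1 = symmDiff M₁.1 M₂.1 := by
    rw [hiff.1 hA, symmDiff_comm]
  refine ⟨hA, hB, ?_⟩
  rintro v ⟨cA, cB⟩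
  have hl := local_eq M₀.2 M₁.2 M₂.2 M₃.2 hA hB
  have cyA : IsCycleSet G (symmDiff M₀.1 M₁.1) := ea ▸ (hFcyc a ha).1
  have cyB : IsCycleSet G (symmDiff M₀.1 M₃.1) := by
    rw [hB, eb]; exact (hFcyc b hb).1
  refine hAB (Eq.trans ?_ hB)
  exact Set.Subset.antisymm (sub_of_local cyA hl v cA cB)
    (sub_of_local cyB (fun v h1 h2 e he => (hl v h2 h1 e he).symm) v cB cA)
end

section
/- Let X be a set of perfect matchings of G such that the subgraph of the resonance graph R(G;F) induced on X is isomorphic to the k-dimensional hypercube Q_k. Let M⁰ ∈ X and let M¹, …, M^k be the k neighbors of M⁰ in this induced subgraph. Then the k even cycles M⁰ Δ M¹, …, M⁰ Δ M^k are pairwise vertex-disjoint: for distinct j, j′, no vertex of G is incident both with an edge of M⁰ Δ M^j and with an edge of M⁰ Δ M^{j′}. -/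
open SimpleGraph

variable {V : Type*} {I : Type*}

/-- The `k`-dimensional hypercube `Q_k`: vertices are the elements of `{0,1}^k`, two of
them being adjacent iff they differ in exactly one coordinate. -/
def hypercube (k : ℕ) : SimpleGraph (Fin k → Bool) :=
  SimpleGraph.fromRel fun a b => ∃! j : Fin k, a j ≠ b j

theorem walk_prop {W : Type*} {H : SimpleGraph W} {S : W → Prop}
    (hstep : ∀ x y, H.Adj x y → S x → S y) {x y : W} (h : H.Reachable x y) (hx : S x) : S y := by
  obtain ⟨w⟩ := h
  induction w with
  | nil => exact hx
  | cons hadj _ ih => exact ih (hstep _ _ hadj hx)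

theorem hc_square {k : ℕ} {a b c : Fin k → Bool} (hb : (hypercube k).Adj a b)
    (hc : (hypercube k).Adj a c) (hbc : b ≠ c) :
    ∃ d, d ≠ a ∧ (hypercube k).Adj b d ∧ (hypercube k).Adj c d := by
  have key : ∀ x y : Fin k → Bool, (hypercube k).Adj x y ↔ ∃! j, x j ≠ y j := by
    intro x y
    simp only [hypercube, SimpleGraph.fromRel_adj]
    constructor
    · rintro ⟨_, h | h⟩
      · exact h
      · simpa only [ne_comm] using h
    · intro h
      refine ⟨?_, Or.inl h⟩
      rintro rfl
      obtain ⟨j, hj, _⟩ := h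
      exact hj rfl
  rw [key] at hb hc
  refine ⟨fun x => xor (a x) (xor (b x) (c x)), ?_, ?_, ?_⟩
  · intro h
    apply hbc
    funext x
    have := congrFun h x
    revert this
    cases a x <;> cases b x <;> cases c x <;> simp
  · rw [key]
    refine (existsUnique_congr fun j => ?_).1 hc
    cases a j <;> cases b j <;> cases c j <;> simp
  · rw [key]
    refine (existsUnique_congr fun j => ?_).1 hb
    cases a j <;> cases b j <;> cases c j <;> simp

theorem res_adj {G : SimpleGraph V} {E : I → Set (Sym2 V)} {F : Set I}
    {A B : {M : Set (Sym2 V) // IsPM G M}} (h : (resGraph G E F).Adj A B) :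
    ∃ i ∈ F, symmDiff A.1 B.1 = E i := by
  simp only [resGraph, SimpleGraph.fromRel_adj] at h
  rcases h with ⟨_, h | h⟩
  · exact h
  · rw [symmDiff_comm]; exact h

theorem face_dep {G : SimpleGraph V} {E : I → Set (Sym2 V)} (hface : IsFaceSystem G E)
    {F : Set I} (hF : F ≠ Set.univ) {i j a b : I} (hi : i ∈ F) (hj : j ∈ F) (ha : a ∈ F)
    (hb : b ∈ F) (hij : i ≠ j) (hia : i ≠ a)
    (h : ∀ e, (Xor (Xor (e ∈ E i) (e ∈ E a)) (Xor (e ∈ E j) (e ∈ E b))) → False) : i = b := by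
  by_contra hib
  obtain ⟨h1, h2, h3⟩ := hface
  let S : I → Prop := fun x => Xor (Xor (x = i) (x = a)) (Xor (x = j) (x = b))
  have hSi : S i := by
    simp [S, Xor, hij, hia, hib]
  have hstep : ∀ x y, (SimpleGraph.fromRel fun i j : I => (E i ∩ E j).Nonempty).Adj x y →
      S x → S y := by
    intro x y hxy hx
    rw [SimpleGraph.fromRel_adj] at hxy
    obtain ⟨hne, hor⟩ := hxy
    have : ∃ e, e ∈ E x ∧ e ∈ E y := by
      rcases hor with ⟨e, he⟩ | ⟨e, he⟩
      · exact ⟨e, he.1, he.2⟩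
      · exact ⟨e, he.2, he.1⟩
    obtain ⟨e, hex, hey⟩ := this
    obtain ⟨p, q, hpq, hset⟩ := Set.ncard_eq_two.1 (h2 e (h1 x hex))
    have hm : ∀ z, e ∈ E z ↔ (z = p ∨ z = q) := by
      intro z
      have : z ∈ {i : I | e ∈ E i} ↔ z ∈ ({p, q} : Set I) := by rw [hset]
      simpa using this
    have hm' : ∀ z, e ∈ E z ↔ (z = x ∨ z = y) := by
      intro z
      have := (hm x).1 hex
      have := (hm y).1 hey
      have := hm z
      grind
    have he := h e
    rw [hm', hm', hm', hm'] at he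
    simp only [S, Xor] at *
    grind
  have hall : ∀ x, S x := by
    intro x
    exact walk_prop hstep (h3.preconnected i x) hSi
  apply hF
  ext x
  have := hall x
  simp only [S, Xor] at this
  simp only [Set.mem_univ, iff_true]
  grind

/-- local analysis at a vertex -/
theorem local_eq_s8 {G : SimpleGraph V} {M0 M1 M2 W : Set (Sym2 V)} (h0 : IsPM G M0)
    (h1 : IsPM G M1) (h2 : IsPM G M2) (hW : IsPM G W)
    (hw : symmDiff M2 W = symmDiff M0 M1) {v : V}
    (c1 : coveredBy (symmDiff M0 M1) v) (c2 : coveredBy (symmDiff M0 M2) v) :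
    ∀ e, v ∈ e → (e ∈ symmDiff M0 M1 ↔ e ∈ symmDiff M0 M2) := by
  obtain ⟨e0, ⟨m0, v0⟩, u0⟩ := h0.2 v
  obtain ⟨e1, ⟨m1, v1⟩, u1⟩ := h1.2 v
  obtain ⟨e2, ⟨m2, v2⟩, u2⟩ := h2.2 v
  obtain ⟨e3, ⟨m3, v3⟩, u3⟩ := hW.2 v
  have a0 : ∀ e, v ∈ e → (e ∈ M0 ↔ e = e0) := fun e he => ⟨fun h => u0 e ⟨h, he⟩, fun h => h ▸ m0⟩
  have a1 : ∀ e, v ∈ e → (e ∈ M1 ↔ e = e1) := fun e he => ⟨fun h => u1 e ⟨h, he⟩, fun h => h ▸ m1⟩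
  have a2 : ∀ e, v ∈ e → (e ∈ M2 ↔ e = e2) := fun e he => ⟨fun h => u2 e ⟨h, he⟩, fun h => h ▸ m2⟩
  have a3 : ∀ e, v ∈ e → (e ∈ W ↔ e = e3) := fun e he => ⟨fun h => u3 e ⟨h, he⟩, fun h => h ▸ m3⟩
  have hw' : ∀ e, v ∈ e → ((e = e2 ∧ e ≠ e3 ∨ e = e3 ∧ e ≠ e2) ↔
      (e = e0 ∧ e ≠ e1 ∨ e = e1 ∧ e ≠ e0)) := by
    intro e he
    have := Set.ext_iff.1 hw e
    simpa only [Set.mem_symmDiff, a0 e he, a1 e he, a2 e he, a3 e he] using this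
  have n1 : e0 ≠ e1 := by
    obtain ⟨e, he, hv⟩ := c1
    rw [Set.mem_symmDiff, a0 e hv, a1 e hv] at he
    grind
  have n2 : e0 ≠ e2 := by
    obtain ⟨e, he, hv⟩ := c2
    rw [Set.mem_symmDiff, a0 e hv, a2 e hv] at he
    grind
  have := hw' e0 v0
  have := hw' e1 v1
  have := hw' e2 v2
  have := hw' e3 v3
  intro e he
  rw [Set.mem_symmDiff, Set.mem_symmDiff, a0 e he, a1 e he, a2 e he]
  grind

theorem sub_aux {G : SimpleGraph V} {A B : Set (Sym2 V)} (hA : IsCycleSet G A)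
    (hloc : ∀ v, coveredBy A v → coveredBy B v → ∀ e, v ∈ e → (e ∈ A ↔ e ∈ B))
    {v : V} (cA : coveredBy A v) (cB : coveredBy B v) : A ⊆ B := by
  have hsup : ∀ u, coveredBy A u → u ∈ (fromEdgeSet A).support := by
    rintro u ⟨e, he, hu⟩
    obtain ⟨w, rfl⟩ := Sym2.mem_iff_exists.1 hu
    rw [SimpleGraph.mem_support]
    refine ⟨w, ?_⟩
    rw [fromEdgeSet_adj]
    exact ⟨he, (SimpleGraph.mem_edgeSet G |>.1 (hA.1 he)).ne⟩
  have hstep : ∀ x y, (fromEdgeSet A).Adj x y → (coveredBy A x ∧ coveredBy B x) →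
      (coveredBy A y ∧ coveredBy B y) := by
    rintro x y hxy ⟨h1, h2⟩
    rw [fromEdgeSet_adj] at hxy
    exact ⟨⟨_, hxy.1, Sym2.mem_mk_right x y⟩,
      ⟨_, (hloc x h1 h2 _ (Sym2.mem_mk_left x y)).1 hxy.1, Sym2.mem_mk_right x y⟩⟩
  intro e
  induction e using Sym2.ind with
  | _ x y =>
    intro he
    have cx : coveredBy A x := ⟨_, he, Sym2.mem_mk_left x y⟩
    have hr := hA.2.2.2 v (hsup v cA) x (hsup x cx)
    have := walk_prop hstep hr ⟨cA, cB⟩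
    exact (hloc x this.1 this.2 _ (Sym2.mem_mk_left x y)).1 he


/-- Let `X` be a set of perfect matchings of `G` such that the subgraph
of `R(G;F)` induced on `X` is isomorphic to `Q_k`, let `M⁰ ∈ X` and let
`N 1, …, N k` be the `k` neighbors of `M⁰` in this induced subgraph.  Then the even
cycles `M⁰ Δ (N j)` are pairwise vertex-disjoint. -/
theorem statement8 [Fintype V] [Fintype I] (G : SimpleGraph V)
    (E : I → Set (Sym2 V)) (hface : IsFaceSystem G E)
    (F : Set I) (hF : F ≠ Set.univ) (hFcyc : ∀ i ∈ F, IsEvenCycleSet G (E i))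
    (k : ℕ) (X : Set {M : Set (Sym2 V) // IsPM G M})
    (hX : Nonempty (((resGraph G E F).induce X) ≃g hypercube k))
    (M0 : {M : Set (Sym2 V) // IsPM G M}) (hM0 : M0 ∈ X)
    (N : Fin k → {M : Set (Sym2 V) // IsPM G M})
    (hNX : ∀ j, N j ∈ X) (hNinj : Function.Injective N)
    (hNadj : ∀ j, (resGraph G E F).Adj M0 (N j))
    (hNall : ∀ W ∈ X, (resGraph G E F).Adj M0 W → ∃ j, N j = W) :
    ∀ j j' : Fin k, j ≠ j' → ∀ v : V,
      ¬ (coveredBy (symmDiff M0.1 (N j).1) v ∧ coveredBy (symmDiff M0.1 (N j').1) v) := by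
  intro j j' hjj v ⟨c1, c2⟩
  obtain ⟨φ⟩ := hX
  have hne : N j ≠ N j' := fun h => hjj (hNinj h)
  have adj1 : (hypercube k).Adj (φ ⟨M0, hM0⟩) (φ ⟨N j, hNX j⟩) :=
    φ.map_adj_iff.2 (hNadj j)
  have adj2 : (hypercube k).Adj (φ ⟨M0, hM0⟩) (φ ⟨N j', hNX j'⟩) :=
    φ.map_adj_iff.2 (hNadj j')
  obtain ⟨d, hd, hd1, hd2⟩ := hc_square adj1 adj2
    (fun h => hne (Subtype.mk.inj (φ.injective h)))
  obtain ⟨⟨W, hWX⟩, rfl⟩ := φ.surjective d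
  have e1 : (resGraph G E F).Adj (N j) W := φ.map_adj_iff.1 hd1
  have e2 : (resGraph G E F).Adj (N j') W := φ.map_adj_iff.1 hd2
  have hWM : W ≠ M0 := by
    rintro rfl
    exact hd rfl
  obtain ⟨p, hp, hpE⟩ := res_adj (hNadj j)
  obtain ⟨q, hq, hqE⟩ := res_adj (hNadj j')
  obtain ⟨a, ha, haE⟩ := res_adj e1
  obtain ⟨b, hb, hbE⟩ := res_adj e2
  have hpq' : symmDiff M0.1 (N j).1 ≠ symmDiff M0.1 (N j').1 := by
    intro h
    exact hne (Subtype.ext (symmDiff_right_injective _ h))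
  have hpq : p ≠ q := by
    rintro rfl
    exact hpq' (hpE.trans hqE.symm)
  have hpa : p ≠ a := by
    rintro rfl
    have h := haE.trans hpE.symm
    rw [symmDiff_comm M0.1] at h
    exact hWM (Subtype.ext (symmDiff_right_injective _ h))
  have hpb : p = b := by
    refine face_dep hface hF hp hq ha hb hpq hpa ?_
    intro e
    rw [← hpE, ← hqE, ← haE, ← hbE]
    simp only [Set.mem_symmDiff, Xor]
    by_cases x0 : e ∈ M0.1 <;> by_cases x1 : e ∈ (N j).1 <;> by_cases x2 : e ∈ (N j').1 <;>
      by_cases x3 : e ∈ W.1 <;> simp [x0, x1, x2, x3]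
  subst hpb
  have hw : symmDiff (N j').1 W.1 = symmDiff M0.1 (N j).1 := hbE.trans hpE.symm
  have hloc : ∀ v, coveredBy (symmDiff M0.1 (N j).1) v → coveredBy (symmDiff M0.1 (N j').1) v →
      ∀ e, v ∈ e → (e ∈ symmDiff M0.1 (N j).1 ↔ e ∈ symmDiff M0.1 (N j').1) :=
    fun v c1 c2 => local_eq_s8 M0.2 (N j).2 (N j').2 W.2 hw c1 c2
  apply hpq'
  apply Set.Subset.antisymm
  · exact sub_aux (hpE ▸ (hFcyc p hp).1) hloc c1 c2
  · exact sub_aux (hqE ▸ (hFcyc q hq).1) (fun v h1 h2 e he => (hloc v h2 h1 e he).symm) c2 c1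
end

section
/- For every natural number k, the number of Clar covers of G with respect to F having exactly k cycle components equals the number of subsets X of the vertex set of the resonance graph R(G;F) such that the subgraph of R(G;F) induced on X is isomorphic to the k-dimensional hypercube Q_k. Equivalently, the Zhang-Zhang polynomial ZZ_F(G,x) = Σ_{k≥0} z_k x^k, where z_k is the number of Clar covers of G with respect to F with exactly k cycle components, equals the cube polynomial C(R(G;F),x) = Σ_{k≥0} α_k x^k, where α_k is the number of induced subgraphs of R(G;F) isomorphic to Q_k. -/
open SimpleGraph

variable {V : Type*} {I : Type*}

/-- `S` is a Clar cover of `G` with respect to the family `F` of cycle edge sets,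
decomposed into its set `𝒞` of cycle components (cycles belonging to `F`) and its set
`M₀` of single-edge components: the cycles are pairwise vertex-disjoint, vertex-disjoint
from the matching `M₀`, and every vertex of `G` is covered.  Equivalently, every
connected component of the spanning subgraph `(V(G), S)` is a single edge or a cycle
belonging to `F`. -/
def IsClarDecomp (G : SimpleGraph V) (F : Set (Set (Sym2 V)))
    (S : Set (Sym2 V)) (𝒞 : Set (Set (Sym2 V))) (M₀ : Set (Sym2 V)) : Prop :=
  𝒞 ⊆ F ∧ M₀ ⊆ G.edgeSet ∧ S = M₀ ∪ ⋃₀ 𝒞 ∧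
  (∀ v : V, {e ∈ M₀ | v ∈ e}.Subsingleton) ∧
  (∀ C₁ ∈ 𝒞, ∀ C₂ ∈ 𝒞, C₁ ≠ C₂ → ∀ v : V, ¬ (coveredBy C₁ v ∧ coveredBy C₂ v)) ∧
  (∀ C ∈ 𝒞, ∀ v : V, coveredBy C v → ¬ coveredBy M₀ v) ∧
  (∀ v : V, coveredBy S v)

/-- uniqueness in a perfect matching -/
lemma IsPM.uniq {G : SimpleGraph V} {M : Set (Sym2 V)} (h : IsPM G M) {v : V} {e e' : Sym2 V}
    (he : e ∈ M) (hv : v ∈ e) (he' : e' ∈ M) (hv' : v ∈ e') : e = e' :=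
  (h.2 v).unique ⟨he, hv⟩ ⟨he', hv'⟩

lemma IsPM.mem_of_symmDiff {G : SimpleGraph V} {N B : Set (Sym2 V)} (h : IsPM G N)
    (h' : IsPM G (symmDiff N B)) {v : V} (hv : coveredBy B v) {e : Sym2 V} (he : e ∈ N)
    (hve : v ∈ e) : e ∈ B := by
  obtain ⟨e', he', hve'⟩ := hv
  by_contra hB
  by_cases h1 : e' ∈ N
  · have := h.uniq he hve h1 hve'
    exact hB (this ▸ he')
  · have := h'.uniq (e := e) (e' := e') (Or.inl ⟨he, hB⟩) hve (Or.inr ⟨he', h1⟩) hve'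
    exact hB (this ▸ he')

lemma IsCycleSet.two {G : SimpleGraph V} {C : Set (Sym2 V)} (h : IsCycleSet G C) {v : V}
    (hv : coveredBy C v) : ∃ e₁ e₂, e₁ ≠ e₂ ∧ e₁ ∈ C ∧ e₂ ∈ C ∧ v ∈ e₁ ∧ v ∈ e₂ ∧
      ∀ e ∈ C, v ∈ e → e = e₁ ∨ e = e₂ := by
  obtain ⟨e, he, hve⟩ := hv
  obtain ⟨w, rfl⟩ := Sym2.mem_iff_exists.1 hve
  have key : ∀ w, s(v, w) ∈ C ↔ (fromEdgeSet C).Adj v w := by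
    intro w
    rw [fromEdgeSet_adj]
    refine ⟨fun hw => ⟨hw, ?_⟩, fun hw => hw.1⟩
    exact G.ne_of_adj (h.1 hw)
  have hs : v ∈ (fromEdgeSet C).support := ⟨w, (key w).1 he⟩
  obtain ⟨a, b, hab, hn⟩ := Set.ncard_eq_two.1 (h.2.2.1 v hs)
  have hm : ∀ w, s(v, w) ∈ C ↔ w = a ∨ w = b := by
    intro w
    rw [key, ← mem_neighborSet, hn]; simp
  refine ⟨s(v, a), s(v, b), fun hh => hab (Sym2.congr_right.1 hh), (hm a).2 (by simp), (hm b).2 (by simp), by simp,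
    by simp, ?_⟩
  intro e he hve
  obtain ⟨w, rfl⟩ := Sym2.mem_iff_exists.1 hve
  rcases (hm w).1 he with rfl | rfl <;> simp

lemma IsCycleSet.eq_of_closed {G : SimpleGraph V} {C D : Set (Sym2 V)} (h : IsCycleSet G C)
    (hD : D ⊆ C) (hne : D.Nonempty)
    (hcl : ∀ v, coveredBy D v → ∀ e ∈ C, v ∈ e → e ∈ D) : D = C := by
  apply hD.antisymm
  have key : ∀ v w, s(v, w) ∈ C → (fromEdgeSet C).Adj v w := by
    intro v w hw
    rw [fromEdgeSet_adj]
    exact ⟨hw, G.ne_of_adj (h.1 hw)⟩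
  obtain ⟨e, he⟩ := hne
  intro f hf
  induction e using Sym2.ind with
  | _ a b =>
  induction f using Sym2.ind with
  | _ c d =>
  obtain ⟨p⟩ := h.2.2.2 a ⟨b, key _ _ (hD he)⟩ c ⟨d, key _ _ hf⟩
  have ha : coveredBy D a := ⟨_, he, by simp⟩
  have hc : ∀ {x y : V} (p : (fromEdgeSet C).Walk x y), coveredBy D x → coveredBy D y := by
    intro x y p
    induction p with
    | nil => exact id
    | cons hadj p ih =>
      intro hx
      apply ih
      rw [fromEdgeSet_adj] at hadj
      exact ⟨_, hcl _ hx _ hadj.1 (by simp), by simp⟩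
  exact hcl _ (hc p ha) _ hf (by simp)

def IsHalf (C A : Set (Sym2 V)) : Prop :=
  A ⊆ C ∧ ∀ v, coveredBy C v → ∃! e, e ∈ A ∧ v ∈ e

lemma IsHalf.compl {G : SimpleGraph V} {C A : Set (Sym2 V)} (h : IsCycleSet G C)
    (hA : IsHalf C A) : IsHalf C (C \ A) := by
  refine ⟨Set.sdiff_subset, fun v hv => ?_⟩
  obtain ⟨e₁, e₂, hne, h1, h2, hv1, hv2, hall⟩ := h.two hv
  obtain ⟨e, ⟨he, hve⟩, hu⟩ := hA.2 v hv
  rcases hall e (hA.1 he) hve with rfl | rfl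
  · refine ⟨e₂, ⟨⟨h2, fun hh => hne (hu _ ⟨hh, hv2⟩).symm⟩, hv2⟩, ?_⟩
    rintro f ⟨⟨hf, hfA⟩, hvf⟩
    rcases hall f hf hvf with rfl | rfl
    · exact absurd he hfA
    · rfl
  · refine ⟨e₁, ⟨⟨h1, fun hh => hne (hu _ ⟨hh, hv1⟩)⟩, hv1⟩, ?_⟩
    rintro f ⟨⟨hf, hfA⟩, hvf⟩
    rcases hall f hf hvf with rfl | rfl
    · rfl
    · exact absurd he hfA

lemma IsHalf.eq_or {G : SimpleGraph V} {C A B : Set (Sym2 V)} (h : IsCycleSet G C)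
    (hA : IsHalf C A) (hB : IsHalf C B) : B = A ∨ B = C \ A := by
  by_cases hne : {e ∈ C | e ∈ A ↔ e ∈ B}.Nonempty
  · left
    have := h.eq_of_closed (D := {e ∈ C | e ∈ A ↔ e ∈ B}) (fun e he => he.1) hne ?_
    · ext e
      constructor
      · intro he
        have : e ∈ {e ∈ C | e ∈ A ↔ e ∈ B} := by rw [this]; exact hB.1 he
        exact this.2.2 he
      · intro he
        have : e ∈ {e ∈ C | e ∈ A ↔ e ∈ B} := by rw [this]; exact hA.1 he
        exact this.2.1 he
    · rintro v ⟨e, ⟨heC, he⟩, hve⟩ f hf hvf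
      refine ⟨hf, ?_⟩
      have hv : coveredBy C v := ⟨e, heC, hve⟩
      obtain ⟨e₁, e₂, hne, h1, h2, hv1, hv2, hall⟩ := h.two hv
      obtain ⟨a, ⟨ha, hva⟩, hua⟩ := hA.2 v hv
      obtain ⟨b, ⟨hb, hvb⟩, hub⟩ := hB.2 v hv
      have := hall a (hA.1 ha) hva
      have := hall b (hB.1 hb) hvb
      have := hall e heC hve
      have := hall f hf hvf
      have := hua e
      have := hua f
      have := hub e
      have := hub f
      grind
  · right
    have hno : ∀ e ∈ C, ¬ (e ∈ A ↔ e ∈ B) := fun e he hh => hne ⟨e, he, hh⟩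
    ext e
    have := hno e
    have := @hA.1 e
    have := @hB.1 e
    simp only [Set.mem_sdiff]
    tauto

lemma IsEvenCycleSet.exists_half [Finite V] {G : SimpleGraph V} {C : Set (Sym2 V)}
    (h : IsEvenCycleSet G C) : ∃ A, IsHalf C A := by
  classical
  have := Fintype.ofFinite V
  obtain ⟨h, hev⟩ := h
  have hcyc : (fromEdgeSet C).IsCycles := by
    intro v hv
    exact h.2.2.1 v hv
  have hes : (fromEdgeSet C).edgeSet = C := by
    rw [edgeSet_fromEdgeSet]
    ext e
    simp only [Set.mem_sdiff, and_iff_left_iff_imp]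
    intro he hd
    exact G.not_isDiag_of_mem_edgeSet (h.1 he) hd
  obtain ⟨e, he⟩ := h.2.1
  induction e using Sym2.ind with
  | _ a b =>
  have hadj : (fromEdgeSet C).Adj a b := by
    rw [← mem_edgeSet, hes]; exact he
  obtain ⟨p, hp, hpv⟩ := hcyc.exists_cycle_toSubgraph_verts_eq_connectedComponentSupp
    (c := (fromEdgeSet C).connectedComponentMk a) (v := a) rfl ⟨b, hadj⟩
  have hsup : ∀ v, coveredBy C v → v ∈ p.support := by
    rintro v ⟨e, he, hve⟩
    obtain ⟨w, rfl⟩ := Sym2.mem_iff_exists.1 hve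
    have hvw : (fromEdgeSet C).Adj v w := by rw [← mem_edgeSet, hes]; exact he
    rw [← Walk.mem_verts_toSubgraph, hpv]
    have := h.2.2.2 v ⟨w, hvw⟩ a ⟨b, hadj⟩
    simpa using this
  have hpe : p.edgeSet = C := by
    apply Set.Subset.antisymm
    · intro e he
      have := p.edges_subset_edgeSet he
      rwa [hes] at this
    · intro e he
      induction e using Sym2.ind with
      | _ v w =>
      have hvw : (fromEdgeSet C).Adj v w := by rw [← mem_edgeSet, hes]; exact he
      have hv : v ∈ p.toSubgraph.verts := by
        rw [Walk.mem_verts_toSubgraph]; exact hsup _ ⟨_, he, by simp⟩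
      rw [← Walk.edgeSet_toSubgraph, Subgraph.mem_edgeSet]
      rwa [hp.adj_toSubgraph_iff_of_isCycles hcyc hv]
  have hlen : Even p.length := by
    have : C.ncard = p.length := by
      refine (congrArg Set.ncard hpe.symm).trans ?_
      rw [← Walk.length_edges, ← List.toFinset_card_of_nodup hp.1.1.edges_nodup,
        ← Set.ncard_coe_finset]
      congr 1
      ext e
      simp [Walk.edgeSet]
    rwa [← this]
  have hinj := hp.getVert_injOn'
  have h3 := hp.three_le_length
  obtain ⟨n, hn⟩ := hlen
  refine ⟨{e | ∃ i < n, e = s(p.getVert (2 * i), p.getVert (2 * i + 1))}, ?_, ?_⟩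
  · rintro e ⟨i, hi, rfl⟩
    refine hes.subset ?_
    rw [mem_edgeSet]
    exact p.adj_getVert_succ (by lia)
  · intro v hv
    obtain ⟨j, hj, hjl⟩ := Walk.mem_support_iff_exists_getVert.1 (hsup v hv)
    have : ∃ j < p.length, p.getVert j = v := by
      rcases hjl.lt_or_eq with hlt | rfl
      · exact ⟨j, hlt, hj⟩
      · exact ⟨0, by lia, by simpa using hj⟩
    obtain ⟨j, hjl, rfl⟩ := this
    refine ⟨s(p.getVert (2 * (j / 2)), p.getVert (2 * (j / 2) + 1)), ⟨⟨j / 2, by lia, rfl⟩, ?_⟩, ?_⟩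
    · rcases Nat.even_or_odd' j with ⟨c, rfl | rfl⟩
      · simp
      · have : (2 * c + 1) / 2 = c := by lia
        simp [this]
    · rintro e ⟨⟨i, hi, rfl⟩, hvi⟩
      have : i = j / 2 := by
        rw [Sym2.mem_iff] at hvi
        rcases hvi with hvi | hvi
        · have := hinj (by simp; lia) (by simp; lia) hvi
          lia
        · have := hinj (by simp; lia) (by simp; lia) hvi
          lia
      rw [this]

lemma face_square {G : SimpleGraph V} {E : I → Set (Sym2 V)} (hface : IsFaceSystem G E)
    {F : Set I} (hF : F ≠ Set.univ) {a b c d : I} (ha : a ∈ F) (hb : b ∈ F) (hc : c ∈ F)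
    (hd : d ∈ F)
    (h : symmDiff (E a) (E c) = symmDiff (E b) (E d)) (hab : a ≠ b) (hac : a ≠ c) :
    c = b ∧ d = a := by
  classical
  let P : I → Prop := fun i => Xor (Xor (i = a) (i = c)) (Xor (i = b) (i = d))
  have hstep : ∀ i j, (SimpleGraph.fromRel fun i j : I => (E i ∩ E j).Nonempty).Adj i j →
      (P i → P j) := by
    intro i j hij
    rw [fromRel_adj] at hij
    obtain ⟨hne, hij⟩ := hij
    have : ∃ e, e ∈ E i ∧ e ∈ E j := by
      rcases hij with ⟨e, h1, h2⟩ | ⟨e, h1, h2⟩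
      · exact ⟨e, h1, h2⟩
      · exact ⟨e, h2, h1⟩
    obtain ⟨e, hei, hej⟩ := this
    obtain ⟨x, y, hxy, hs⟩ := Set.ncard_eq_two.1 (hface.2.1 e (hface.1 i hei))
    have hm : ∀ t, e ∈ E t ↔ t = x ∨ t = y := by
      intro t
      have : t ∈ {i : I | e ∈ E i} ↔ t ∈ ({x, y} : Set I) := by rw [hs]
      simpa using this
    have hm' : ∀ t, e ∈ E t ↔ t = i ∨ t = j := by
      intro t
      have h1 := (hm i).1 hei
      have h2 := (hm j).1 hej
      rw [hm]
      grind
    have he : e ∈ symmDiff (E a) (E c) ↔ e ∈ symmDiff (E b) (E d) := by rw [h]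
    simp only [Set.mem_symmDiff, hm'] at he
    simp only [P, Xor]
    grind
  obtain ⟨o, ho⟩ := (Set.ne_univ_iff_exists_notMem F).1 hF
  have hno : ∀ i, ¬ P i := by
    intro i hi
    obtain ⟨p⟩ := hface.2.2.1 i o
    have : ∀ {x y} (p : (SimpleGraph.fromRel fun i j : I => (E i ∩ E j).Nonempty).Walk x y),
        P x → P y := by
      intro x y p
      induction p with
      | nil => exact id
      | cons hadj p ih => exact fun hx => ih (hstep _ _ hadj hx)
    have := this p hi
    simp only [P, Xor] at this
    grind
  have h1 := hno a
  have h2 := hno c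
  simp only [P, Xor] at h1 h2
  grind

lemma face_disjoint {G : SimpleGraph V} {A B M : Set (Sym2 V)} (hA : IsCycleSet G A)
    (hB : IsCycleSet G B) (hAB : A ≠ B) (h1 : IsPM G M) (h2 : IsPM G (symmDiff M A))
    (h3 : IsPM G (symmDiff M B)) (h4 : IsPM G (symmDiff (symmDiff M A) B))
    (v : V) : ¬ (coveredBy A v ∧ coveredBy B v) := by
  rintro ⟨hvA, hvB⟩
  have h4' : IsPM G (symmDiff (symmDiff M B) A) := by
    rwa [symmDiff_right_comm]
  have key : ∀ {A B : Set (Sym2 V)}, IsPM G (symmDiff M A) →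
      IsPM G (symmDiff M B) → IsPM G (symmDiff (symmDiff M A) B) →
      ∀ v, coveredBy B v → ∀ e ∈ A, v ∈ e → e ∈ B := by
    intro A B h2 h3 h4 v hv e he hve
    by_cases heM : e ∈ M
    · exact h1.mem_of_symmDiff h3 hv heM hve
    · exact h2.mem_of_symmDiff h4 hv (Or.inr ⟨he, heM⟩) hve
  have hne : (A ∩ B).Nonempty := by
    obtain ⟨e, he, hve⟩ := hvA
    exact ⟨e, he, key h2 h3 h4 v hvB e he hve⟩
  have e1 : A ∩ B = A := by
    apply hA.eq_of_closed Set.inter_subset_left hne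
    rintro v ⟨f, hf, hvf⟩ e he hve
    exact ⟨he, key h2 h3 h4 v ⟨f, hf.2, hvf⟩ e he hve⟩
  have e2 : A ∩ B = B := by
    apply hB.eq_of_closed Set.inter_subset_right hne
    rintro v ⟨f, hf, hvf⟩ e he hve
    exact ⟨key h3 h2 h4' v ⟨f, hf.1, hvf⟩ e he hve, he⟩
  exact hAB (e1.symm.trans e2)

lemma hypercube_adj {k : ℕ} (x y : Fin k → Bool) :
    (hypercube k).Adj x y ↔ ∃! j, x j ≠ y j := by
  unfold hypercube
  rw [fromRel_adj]
  constructor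
  · rintro ⟨_, h | h⟩
    · exact h
    · simpa only [ne_comm] using h
  · intro h
    refine ⟨?_, Or.inl h⟩
    rintro rfl
    obtain ⟨j, hj, _⟩ := h
    exact hj rfl

lemma resGraph_adj {G : SimpleGraph V} {E : I → Set (Sym2 V)} {F : Set I}
    (M N : {M : Set (Sym2 V) // IsPM G M}) :
    (resGraph G E F).Adj M N ↔ M ≠ N ∧ ∃ i ∈ F, symmDiff M.1 N.1 = E i := by
  unfold resGraph
  rw [fromRel_adj, symmDiff_comm N.1 M.1, or_self]

lemma clar_cube [Finite V] {G : SimpleGraph V} {E : I → Set (Sym2 V)} {F : Set I}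
    (hFcyc : ∀ i ∈ F, IsEvenCycleSet G (E i)) {S : Set (Sym2 V)} {𝒞 : Set (Set (Sym2 V))}
    {M₀ : Set (Sym2 V)} (h : IsClarDecomp G (E '' F) S 𝒞 M₀) :
    Nonempty ((resGraph G E F).induce {M | M.1 ⊆ S} ≃g hypercube 𝒞.ncard) ∧
      ∀ e ∈ S, ∃ M, IsPM G M ∧ M ⊆ S ∧ e ∈ M := by
  classical
  obtain ⟨hCF, hM0, hS, hM0s, hdis, hdis0, hcov⟩ := h
  generalize hk : 𝒞.ncard = k
  let ε : Fin k ≃ 𝒞 := (Finite.equivFinOfCardEq (by rw [Nat.card_coe_set_eq, hk])).symm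
  obtain ⟨C, hCdef⟩ : ∃ C : Fin k → Set (Sym2 V), ∀ j, C j = (ε j).1 := ⟨_, fun _ => rfl⟩
  have hCm : ∀ j, C j ∈ 𝒞 := fun j => hCdef j ▸ (ε j).2
  have hCs : ∀ c ∈ 𝒞, ∃ j, C j = c := fun c hc => ⟨ε.symm ⟨c, hc⟩, by simp [hCdef]⟩
  have hCi : Function.Injective C := fun i j hij => by
    rw [hCdef, hCdef] at hij
    exact ε.injective (Subtype.ext hij)
  have hev : ∀ j, IsEvenCycleSet G (C j) := fun j => by
    obtain ⟨i, hi, hE⟩ := hCF (hCm j)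
    rw [← hE]; exact hFcyc i hi
  -- vertex disjointness
  have hd : ∀ i j v, coveredBy (C i) v → coveredBy (C j) v → i = j := by
    intro i j v hi hj
    by_contra hne
    exact hdis _ (hCm i) _ (hCm j) (fun hh => hne (hCi hh)) v ⟨hi, hj⟩
  have hd0 : ∀ j v, coveredBy (C j) v → ¬ coveredBy M₀ v := fun j => hdis0 _ (hCm j)
  have hvx : ∀ e : Sym2 V, ∃ v, v ∈ e := fun e => ⟨_, e.out_fst_mem⟩
  have hde : ∀ i j e, e ∈ C i → e ∈ C j → i = j := by
    intro i j e hi hj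
    obtain ⟨v, hv⟩ := hvx e
    exact hd i j v ⟨e, hi, hv⟩ ⟨e, hj, hv⟩
  have hde0 : ∀ j e, e ∈ C j → e ∉ M₀ := by
    intro j e hi hj
    obtain ⟨v, hv⟩ := hvx e
    exact hd0 j v ⟨e, hi, hv⟩ ⟨e, hj, hv⟩
  have hSm : ∀ e, e ∈ S ↔ e ∈ M₀ ∨ ∃ j, e ∈ C j := by
    intro e
    rw [hS]
    constructor
    · rintro (he | ⟨c, hc, he⟩)
      · exact Or.inl he
      · obtain ⟨j, rfl⟩ := hCs c hc
        exact Or.inr ⟨j, he⟩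
    · rintro (he | ⟨j, he⟩)
      · exact Or.inl he
      · exact Or.inr ⟨_, hCm j, he⟩
  choose A hA using fun j => (hev j).exists_half
  obtain ⟨m, hm⟩ : ∃ m : (Fin k → Bool) → Set (Sym2 V), ∀ x e, e ∈ m x ↔
      e ∈ M₀ ∨ ∃ j, e ∈ C j ∧ (e ∈ A j ↔ x j = true) :=
    ⟨fun x => {e | e ∈ M₀ ∨ ∃ j, e ∈ C j ∧ (e ∈ A j ↔ x j = true)}, fun _ _ => Iff.rfl⟩
  have hmC : ∀ x j e, e ∈ C j → (e ∈ m x ↔ (e ∈ A j ↔ x j = true)) := by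
    intro x j e he
    rw [hm]
    constructor
    · rintro (h0 | ⟨i, hi, hh⟩)
      · exact absurd h0 (hde0 _ _ he)
      · obtain rfl := hde _ _ _ he hi
        exact hh
    · exact fun hh => Or.inr ⟨j, he, hh⟩
  have hmS : ∀ x, m x ⊆ S := by
    intro x e he
    rw [hSm]
    rcases (hm _ _).1 he with h | ⟨j, h, _⟩
    · exact Or.inl h
    · exact Or.inr ⟨j, h⟩
  have hSG : S ⊆ G.edgeSet := by
    intro e he
    rcases (hSm e).1 he with h | ⟨j, h⟩
    · exact hM0 h
    · exact (hev j).1.1 h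
  have hmPM : ∀ x, IsPM G (m x) := by
    intro x
    refine ⟨(hmS x).trans hSG, fun v => ?_⟩
    obtain ⟨e, he, hve⟩ := hcov v
    rcases (hSm e).1 he with h0 | ⟨j, hj⟩
    · refine ⟨e, ⟨(hm _ _).2 (Or.inl h0), hve⟩, ?_⟩
      rintro f ⟨hf, hvf⟩
      rcases (hm _ _).1 hf with hf0 | ⟨i, hi, _⟩
      · exact hM0s v ⟨hf0, hvf⟩ ⟨h0, hve⟩
      · exact absurd ⟨e, h0, hve⟩ (hd0 i v ⟨f, hi, hvf⟩)
    · have hcv : coveredBy (C j) v := ⟨e, hj, hve⟩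
      have hH : ∃! f, (f ∈ C j ∧ (f ∈ A j ↔ x j = true)) ∧ v ∈ f := by
        cases hxj : x j
        · have := ((hA j).compl (hev j).1).2 v hcv
          simpa using this
        · have := (hA j).2 v hcv
          have hsub := fun f => @(hA j).1 f
          obtain ⟨f, hf, hu⟩ := this
          exact ⟨f, ⟨⟨hsub _ hf.1, by simpa using hf.1⟩, hf.2⟩,
            fun g hg => hu g ⟨by simpa using hg.1.2, hg.2⟩⟩
      obtain ⟨f, ⟨hf, hvf⟩, hu⟩ := hH
      refine ⟨f, ⟨(hm _ _).2 (Or.inr ⟨j, hf⟩), hvf⟩, ?_⟩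
      rintro g ⟨hg, hvg⟩
      rcases (hm _ _).1 hg with hg0 | ⟨i, hi, hh⟩
      · exact absurd ⟨g, hg0, hvg⟩ (hd0 j v hcv)
      · obtain rfl := hd _ _ _ hcv ⟨g, hi, hvg⟩
        exact hu g ⟨⟨hi, hh⟩, hvg⟩
  have hsd : ∀ x y e, e ∈ symmDiff (m x) (m y) ↔ ∃ j, e ∈ C j ∧ x j ≠ y j := by
    intro x y e
    by_cases hC : ∃ j, e ∈ C j
    · obtain ⟨j, hj⟩ := hC
      have : (∃ j, e ∈ C j ∧ x j ≠ y j) ↔ x j ≠ y j := by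
        constructor
        · rintro ⟨i, hi, hh⟩
          obtain rfl := hde _ _ _ hj hi
          exact hh
        · exact fun hh => ⟨j, hj, hh⟩
      rw [this, Set.mem_symmDiff, hmC x j e hj, hmC y j e hj]
      by_cases hh : e ∈ A j <;> cases x j <;> cases y j <;> simp [hh]
    · push Not at hC
      rw [Set.mem_symmDiff, hm, hm]
      simp [hC]
  have hminj : Function.Injective m := by
    intro x y hxy
    by_contra hne
    obtain ⟨j, hj⟩ := Function.ne_iff.1 hne
    obtain ⟨e, he⟩ := (hev j).1.2.1
    have := (hsd x y e).2 ⟨j, he, hj⟩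
    rw [hxy, symmDiff_self] at this
    exact this
  have hmsurj : ∀ M, IsPM G M → M ⊆ S → ∃ x, m x = M := by
    intro M hM hMS
    have hhalf : ∀ j, IsHalf (C j) (M ∩ C j) := by
      intro j
      refine ⟨Set.inter_subset_right, fun v hv => ?_⟩
      obtain ⟨e, ⟨he, hve⟩, hu⟩ := hM.2 v
      refine ⟨e, ⟨⟨he, ?_⟩, hve⟩, fun f hf => hu f ⟨hf.1.1, hf.2⟩⟩
      rcases (hSm e).1 (hMS he) with h0 | ⟨i, hi⟩
      · exact absurd ⟨e, h0, hve⟩ (hd0 j v hv)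
      · obtain rfl := hd _ _ _ hv ⟨e, hi, hve⟩
        exact hi
    refine ⟨fun j => decide (M ∩ C j = A j), ?_⟩
    ext e
    by_cases hC : ∃ j, e ∈ C j
    · obtain ⟨j, hj⟩ := hC
      rw [hmC _ j e hj]
      by_cases hdec : M ∩ C j = A j
      · simp only [hdec, decide_true, iff_true]
        rw [← hdec]; simp [hj]
      · have := ((hA j).eq_or (hev j).1 (hhalf j)).resolve_left hdec
        simp only [hdec, decide_false, Bool.false_eq_true, iff_false]
        have h2 : e ∈ M ∩ C j ↔ e ∈ C j \ A j := by rw [this]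
        simp only [Set.mem_inter_iff, hj, and_true, Set.mem_sdiff, true_and] at h2
        exact h2.symm
    · push Not at hC
      rw [hm]
      simp only [hC, false_and, exists_false, or_false]
      constructor
      · intro he
        obtain ⟨v, hv⟩ := hvx e
        obtain ⟨f, ⟨hf, hvf⟩, _⟩ := hM.2 v
        rcases (hSm f).1 (hMS hf) with h0 | ⟨i, hi⟩
        · obtain rfl := hM0s v ⟨h0, hvf⟩ ⟨he, hv⟩
          exact hf
        · exact absurd ⟨e, he, hv⟩ (hd0 i v ⟨f, hi, hvf⟩)
      · intro he
        rcases (hSm e).1 (hMS he) with h0 | ⟨i, hi⟩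
        · exact h0
        · exact absurd hi (hC i)
  constructor
  · let φ : (Fin k → Bool) → ({M | M.1 ⊆ S} : Set {M : Set (Sym2 V) // IsPM G M}) :=
      fun x => ⟨⟨m x, hmPM x⟩, hmS x⟩
    have hφ : Function.Bijective φ := by
      constructor
      · intro x y hxy
        exact hminj (congrArg (fun z => z.1.1) hxy)
      · rintro ⟨⟨M, hM⟩, hMS⟩
        obtain ⟨x, hx⟩ := hmsurj M hM hMS
        exact ⟨x, Subtype.ext (Subtype.ext hx)⟩
    refine ⟨SimpleGraph.Iso.symm ⟨Equiv.ofBijective φ hφ, ?_⟩⟩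
    intro x y
    rw [hypercube_adj, Equiv.ofBijective_apply, Equiv.ofBijective_apply, comap_adj, resGraph_adj]
    change (_ ∧ ∃ i ∈ F, symmDiff (m x) (m y) = E i) ↔ _
    constructor
    · rintro ⟨hne, i, hi, hE⟩
      have hxy : x ≠ y := by rintro rfl; exact hne rfl
      obtain ⟨j, hj⟩ := Function.ne_iff.1 hxy
      have hEi := (hFcyc i hi).1
      have hmemE : ∀ e, e ∈ E i ↔ ∃ j, e ∈ C j ∧ x j ≠ y j := fun e => by rw [← hE, hsd]
      have hCE : C j = E i := by
        apply hEi.eq_of_closed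
        · exact fun e he => (hmemE e).2 ⟨j, he, hj⟩
        · exact (hev j).1.2.1
        · intro v hv e he hve
          obtain ⟨l, hl, _⟩ := (hmemE e).1 he
          obtain rfl := hd _ _ _ hv ⟨e, hl, hve⟩
          exact hl
      refine ⟨j, hj, fun l hl => ?_⟩
      obtain ⟨e, he⟩ := (hev l).1.2.1
      have : e ∈ C j := hCE ▸ (hmemE e).2 ⟨l, he, hl⟩
      exact hde _ _ _ he this
    · rintro ⟨j, hj, hu⟩
      refine ⟨?_, ?_⟩
      · intro hh
        exact hj (congrFun (hminj (congrArg (fun z => z.1) hh)) j)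
      · obtain ⟨i, hi, hE⟩ := hCF (hCm j)
        refine ⟨i, hi, ?_⟩
        rw [hE]
        ext e
        rw [hsd]
        constructor
        · rintro ⟨l, hl, hne⟩
          rwa [← hu l hne]
        · exact fun he => ⟨j, he, hj⟩
  · intro e he
    rcases (hSm e).1 he with h0 | ⟨j, hj⟩
    · exact ⟨m fun _ => true, hmPM _, hmS _, (hm _ _).2 (Or.inl h0)⟩
    · exact ⟨m fun _ => decide (e ∈ A j), hmPM _, hmS _, (hmC _ _ _ hj).2 (by simp)⟩

def flipAt {k : ℕ} (x : Fin k → Bool) (j : Fin k) : Fin k → Bool := fun i =>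
  if i = j then !x i else x i

lemma flipAt_adj {k : ℕ} (x : Fin k → Bool) (j : Fin k) :
    (hypercube k).Adj x (flipAt x j) := by
  rw [hypercube_adj]
  refine ⟨j, by simp [flipAt], fun i hi => ?_⟩
  by_contra hne
  simp [flipAt, hne] at hi

lemma flipAt_flipAt {k : ℕ} (x : Fin k → Bool) (j : Fin k) : flipAt (flipAt x j) j = x := by
  funext i
  simp only [flipAt]
  split_ifs <;> simp

lemma flipAt_comm {k : ℕ} (x : Fin k → Bool) (i j : Fin k) :
    flipAt (flipAt x j) i = flipAt (flipAt x i) j := by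
  funext l
  simp only [flipAt]
  split_ifs <;> simp

lemma flipAt_inj {k : ℕ} (x : Fin k → Bool) {i j : Fin k} (h : flipAt x i = flipAt x j) :
    i = j := by
  by_contra hne
  have := congrFun h i
  simp [flipAt, hne] at this

lemma flip_induction {k : ℕ} {P : (Fin k → Bool) → Prop} (h0 : P fun _ => false)
    (hs : ∀ x j, P x → P (flipAt x j)) (x : Fin k → Bool) : P x := by
  have : ∀ s : Finset (Fin k), P fun j => decide (j ∈ s) := by
    intro s
    induction s using Finset.induction_on with
    | empty => simpa using h0
    | insert a s ha ih =>
      convert hs _ a ih using 1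
      funext i
      by_cases hi : i = a
      · subst hi; simp [flipAt, ha]
      · simp [flipAt, hi]
  have := this (Finset.univ.filter fun j => x j = true)
  simpa using this

lemma cube_clar {G : SimpleGraph V} {E : I → Set (Sym2 V)}
    (hface : IsFaceSystem G E) {F : Set I} (hF : F ≠ Set.univ)
    (hFcyc : ∀ i ∈ F, IsEvenCycleSet G (E i)) {k : ℕ}
    {X : Set {M : Set (Sym2 V) // IsPM G M}}
    (φ : (resGraph G E F).induce X ≃g hypercube k) :
    ∃ S 𝒞 M₀, IsClarDecomp G (E '' F) S 𝒞 M₀ ∧ 𝒞.ncard = k ∧ ∀ M ∈ X, M.1 ⊆ S := by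
  classical
  obtain ⟨m, hmdef⟩ : ∃ m : (Fin k → Bool) → Set (Sym2 V), ∀ x, m x = (φ.symm x).1.1 :=
    ⟨_, fun _ => rfl⟩
  have hPM : ∀ x, IsPM G (m x) := fun x => hmdef x ▸ (φ.symm x).1.2
  have hinj : Function.Injective m := by
    intro x y hxy
    rw [hmdef, hmdef] at hxy
    exact φ.symm.injective (Subtype.ext (Subtype.ext hxy))
  have hlab : ∀ x j, ∃ i ∈ F, symmDiff (m x) (m (flipAt x j)) = E i := by
    intro x j
    have := φ.symm.map_rel_iff.2 (flipAt_adj x j)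
    rw [comap_adj, resGraph_adj] at this
    rw [hmdef, hmdef]
    exact this.2
  choose l hlF hl using hlab
  have hmf : ∀ x j, m (flipAt x j) = symmDiff (m x) (E (l x j)) := by
    intro x j
    rw [← hl, symmDiff_symmDiff_cancel_left]
  have hsq : ∀ x i j, i ≠ j → l x i ≠ l x j ∧ l (flipAt x j) i = l x i := by
    intro x i j hij
    have hne : l x i ≠ l x j := by
      intro hh
      apply hij
      apply flipAt_inj x
      apply hinj
      rw [hmf, hmf, hh]
    refine ⟨hne, ?_⟩
    have e1 : m (flipAt (flipAt x i) j) =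
        symmDiff (m x) (symmDiff (E (l x i)) (E (l (flipAt x i) j))) := by
      rw [hmf, hmf, symmDiff_assoc]
    have e2 : m (flipAt (flipAt x i) j) =
        symmDiff (m x) (symmDiff (E (l x j)) (E (l (flipAt x j) i))) := by
      rw [flipAt_comm, hmf, hmf, symmDiff_assoc]
    have e3 := symmDiff_right_injective _ (e1.symm.trans e2)
    refine (face_square hface hF (hlF _ _) (hlF _ _) (hlF _ _) (hlF _ _) e3 hne ?_).2
    intro hh
    rw [← hh, symmDiff_self, symmDiff_bot] at e1
    have e4 := congrFun (hinj e1) i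
    simp [flipAt, hij] at e4
  have hEinj : ∀ x i j, i ≠ j → E (l x i) ≠ E (l x j) := by
    intro x i j hij hh
    apply hij
    apply flipAt_inj x
    apply hinj
    rw [hmf, hmf, hh]
  obtain ⟨C, hC⟩ : ∃ C : Fin k → Set (Sym2 V), ∀ j, C j = E (l (fun _ => false) j) :=
    ⟨_, fun _ => rfl⟩
  have hconst : ∀ x, ∀ i, E (l x i) = C i := by
    intro x
    induction x using flip_induction with
    | h0 => exact fun i => (hC i).symm
    | hs x j ih =>
      intro i
      by_cases hij : i = j
      · subst hij
        rw [← ih, ← hl, ← hl, flipAt_flipAt, symmDiff_comm]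
      · rw [(hsq x i j hij).2, ih]
  have hmf' : ∀ x j, m (flipAt x j) = symmDiff (m x) (C j) := fun x j => by rw [hmf, hconst]
  have hCcyc : ∀ j, IsCycleSet G (C j) := fun j => by
    rw [hC]; exact (hFcyc _ (hlF _ _)).1
  have hCinj : Function.Injective C := by
    intro i j hij
    by_contra hne
    rw [hC, hC] at hij
    exact hEinj _ _ _ hne hij
  have hdis : ∀ i j, i ≠ j → ∀ v, ¬ (coveredBy (C i) v ∧ coveredBy (C j) v) := by
    intro i j hij v
    let x : Fin k → Bool := fun _ => false
    refine face_disjoint (M := m x) (hCcyc i) (hCcyc j) (fun hh => hij (hCinj hh)) (hPM x) ?_ ?_ ?_ v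
    · rw [← hmf']; exact hPM _
    · rw [← hmf']; exact hPM _
    · rw [← hmf', ← hmf']; exact hPM _
  let o : Fin k → Bool := fun _ => false
  have hoS : m o ⊆ (m o \ ⋃₀ Set.range C) ∪ ⋃₀ Set.range C := by
    intro e he
    by_cases h : e ∈ ⋃₀ Set.range C
    · exact Or.inr h
    · exact Or.inl ⟨he, h⟩
  refine ⟨_, Set.range C, m o \ ⋃₀ Set.range C, ⟨?_, ?_, rfl, ?_, ?_, ?_, ?_⟩, ?_, ?_⟩
  · rintro _ ⟨j, rfl⟩
    exact ⟨_, hlF _ j, (hC j).symm⟩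
  · exact fun e he => (hPM o).1 he.1
  · rintro v e ⟨he, hve⟩ f ⟨hf, hvf⟩
    exact (hPM o).uniq he.1 hve hf.1 hvf
  · rintro _ ⟨i, rfl⟩ _ ⟨j, rfl⟩ hne v
    exact hdis i j (fun hh => hne (by rw [hh])) v
  · rintro _ ⟨i, rfl⟩ v hv ⟨e, ⟨he, hn⟩, hve⟩
    apply hn
    refine ⟨C i, ⟨i, rfl⟩, ?_⟩
    refine (hPM o).mem_of_symmDiff ?_ hv he hve
    rw [← hmf']; exact hPM _
  · intro v
    obtain ⟨e, ⟨he, hve⟩, _⟩ := (hPM o).2 v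
    exact ⟨e, hoS he, hve⟩
  · rw [← Set.image_univ, Set.ncard_image_of_injective _ hCinj, Set.ncard_univ]
    simp
  · have hall : ∀ x, m x ⊆ (m o \ ⋃₀ Set.range C) ∪ ⋃₀ Set.range C := by
      intro x
      induction x using flip_induction with
      | h0 => exact hoS
      | hs x j ih =>
        rw [hmf']
        rintro e (⟨he, _⟩ | ⟨he, _⟩)
        · exact ih he
        · exact Or.inr ⟨C j, ⟨j, rfl⟩, he⟩
    intro M hM
    have := hall (φ ⟨M, hM⟩)
    rw [hmdef] at this
    simpa using this

/-- For every `k`, the number of Clar covers of `G` with respect to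
`F` (cycle components taken among the `E i`, `i ∈ F`) with exactly `k` cycle components
equals the number of vertex subsets `X` of `R(G;F)` whose induced subgraph is isomorphic
to the hypercube `Q_k`; i.e. the Zhang-Zhang polynomial of `G` with respect to `F`
equals the cube polynomial of `R(G;F)`. -/
theorem statement11 [Fintype V] [Fintype I] (G : SimpleGraph V)
    (E : I → Set (Sym2 V)) (hface : IsFaceSystem G E)
    (F : Set I) (hF : F ≠ Set.univ) (hFcyc : ∀ i ∈ F, IsEvenCycleSet G (E i)) :
    ∀ k : ℕ,
      {S : Set (Sym2 V) | ∃ (𝒞 : Set (Set (Sym2 V))) (M₀ : Set (Sym2 V)),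
          IsClarDecomp G (E '' F) S 𝒞 M₀ ∧ 𝒞.ncard = k}.ncard =
      {X : Set {M : Set (Sym2 V) // IsPM G M} |
          Nonempty (((resGraph G E F).induce X) ≃g hypercube k)}.ncard := by
  intro k
  refine Set.BijOn.ncard_eq (f := fun S => {M | M.1 ⊆ S}) ⟨?_, ?_, ?_⟩
  · rintro S ⟨𝒞, M₀, h, rfl⟩
    exact (clar_cube hFcyc h).1
  · rintro S ⟨𝒞, M₀, h, -⟩ T ⟨𝒟, N₀, h', -⟩ hST
    have hST' : ∀ M : {M : Set (Sym2 V) // IsPM G M}, M.1 ⊆ S ↔ M.1 ⊆ T := by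
      intro M
      exact iff_of_eq (congrArg (fun Z => M ∈ Z) hST)
    apply Set.Subset.antisymm
    · intro e he
      obtain ⟨M, hM, hMS, heM⟩ := (clar_cube hFcyc h).2 e he
      exact (hST' ⟨M, hM⟩).1 hMS heM
    · intro e he
      obtain ⟨M, hM, hMS, heM⟩ := (clar_cube hFcyc h').2 e he
      exact (hST' ⟨M, hM⟩).2 hMS heM
  · rintro X ⟨φ⟩
    obtain ⟨S, 𝒞, M₀, h, hk, hX⟩ := cube_clar hface hF hFcyc φ
    refine ⟨S, ⟨𝒞, M₀, h, hk⟩, ?_⟩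
    obtain ⟨ψ⟩ := (clar_cube hFcyc h).1
    rw [hk] at ψ
    symm
    apply Set.eq_of_subset_of_ncard_le (fun M hM => hX M hM) _ (Set.toFinite _)
    exact (Set.ncard_congr' (ψ.toEquiv.trans φ.toEquiv.symm)).le
end
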